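/- arXiv:2012.11252 — 2 statements merged into one kernel-verified Lean document; each statement's English description precedes it below -/
import Mathlib

section
/- Let g ∈ H^∞(𝔻) with g(0) ≠ 0 and θ a non-constant inner function. Then the closure of g·K_θ in H^2(𝔻) is nearly S*-invariant: whenever f is in the closure of gK_θ and f(0) = 0, then S*f = f/z also lies in the closure of gK_θ. -/
open Complex MeasureTheory Metric Set

/-- Taylor coefficient at 0. -/
noncomputable def hcoeff (f : ℂ → ℂ) (n : ℕ) : ℂ := iteratedDeriv n f 0 / n.factorial

/-- H² inner product via Taylor coefficients (conjugate-linear in first slot). -/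
noncomputable def hinner (f g : ℂ → ℂ) : ℂ :=
  ∑' n : ℕ, (starRingEnd ℂ) (hcoeff f n) * hcoeff g n

/-- H² squared norm via Taylor coefficients. -/
noncomputable def hnormSq (f : ℂ → ℂ) : ℝ := ∑' n : ℕ, ‖hcoeff f n‖ ^ 2

/-- Membership in the Hardy space H²(𝔻). -/
def MemH2 (f : ℂ → ℂ) : Prop :=
  DifferentiableOn ℂ f (ball 0 1) ∧ Summable fun n : ℕ => ‖hcoeff f n‖ ^ 2

/-- Inner function on the unit disc. -/
def IsInner (u : ℂ → ℂ) : Prop :=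
  DifferentiableOn ℂ u (ball 0 1) ∧ (∀ z ∈ ball (0 : ℂ) 1, ‖u z‖ ≤ 1) ∧
    ∀ᵐ t : ℝ, Filter.Tendsto (fun r : ℝ => ‖u ((r : ℂ) * Complex.exp (Complex.I * t))‖)
      (nhdsWithin 1 (Set.Iio 1)) (nhds 1)

/-- Membership in the model space K_u = H² ⊖ uH². -/
def MemK (u f : ℂ → ℂ) : Prop :=
  MemH2 f ∧ ∀ g, MemH2 g → hinner (fun z => u z * g z) f = 0

/-- The powers of the atomic singular inner function. -/
noncomputable def phi (lam : ℝ) (z : ℂ) : ℂ := Complex.exp (-(lam : ℂ) * (1 - z) / (1 + z))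

/-- Membership in the closed linear span of a family {F λ : λ ∈ A} in H². -/
def InClosedSpan (F : ℝ → ℂ → ℂ) (A : Set ℝ) (f : ℂ → ℂ) : Prop :=
  MemH2 f ∧ ∀ ε > 0, ∃ (n : ℕ) (c : Fin n → ℂ) (lam : Fin n → ℝ),
    (∀ i, lam i ∈ A) ∧ hnormSq (fun z => f z - ∑ i, c i * F (lam i) z) < ε


theorem hs_an {f : ℂ → ℂ} (hf : DifferentiableOn ℂ f (ball 0 1)) : AnalyticAt ℂ f 0 :=
  hf.analyticAt (isOpen_ball.mem_nhds (mem_ball_self one_pos))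

theorem hs_sum {f : ℂ → ℂ} (hf : DifferentiableOn ℂ f (ball 0 1)) {z : ℂ}
    (hz : z ∈ ball (0 : ℂ) 1) : HasSum (fun n => hcoeff f n * z ^ n) (f z) := by
  have := hasSum_taylorSeries_on_ball hf hz
  have e : (fun n => hcoeff f n * z ^ n) =
      fun n : ℕ => ((n.factorial : ℂ)⁻¹ • (z - 0) ^ n • iteratedDeriv n f 0) := by
    ext n
    simp only [hcoeff, smul_eq_mul, sub_zero]
    ring
  rw [e]
  exact this

theorem hs_orth {E : Type*} [NormedAddCommGroup E] [InnerProductSpace ℂ E] {e : ℕ → E}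
    (he : Orthonormal ℂ e) {c : ℕ → ℂ} {x : E} (h : HasSum (fun n => c n • e n) x) :
    HasSum (fun n => ‖c n‖ ^ 2) (‖x‖ ^ 2) := by
  have h1 : ∀ m, inner ℂ (e m) x = c m := by
    intro m
    have h2 : HasSum (fun n => inner ℂ (e m) (c n • e n)) (inner ℂ (e m) x) :=
      h.mapL (innerSL ℂ (e m))
    refine h2.unique ?_
    convert hasSum_ite_eq m (c m) using 2 with n
    rw [inner_smul_right, orthonormal_iff_ite.1 he]
    by_cases hmn : m = n
    · simp [hmn]
    · simp [hmn, Ne.symm hmn]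
  have h3 : HasSum (fun n => inner ℂ x (c n • e n)) (inner ℂ x x) :=
    h.mapL (innerSL ℂ x)
  have h4 : HasSum (fun n => ((‖c n‖ ^ 2 : ℝ) : ℂ)) ((‖x‖ ^ 2 : ℝ) : ℂ) := by
    convert h3 using 2 with n
    · rw [inner_smul_right, ← inner_conj_symm, h1, Complex.mul_conj, Complex.normSq_eq_norm_sq]
    · rw [inner_self_eq_norm_sq_to_K]; simp
  exact_mod_cast h4

theorem hs_mem {r : ℝ} (h0 : 0 ≤ r) (h1 : r < 1) (t : UnitAddCircle) :
    (r * fourier 1 t : ℂ) ∈ ball (0 : ℂ) 1 := by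
  rw [mem_ball_zero_iff, norm_mul, fourier_apply, Circle.norm_coe, mul_one, Complex.norm_real,
    Real.norm_eq_abs, abs_of_nonneg h0]
  exact h1

/-- The dilation of `f` to the circle. -/
noncomputable def hs_circ (f : ℂ → ℂ) (hf : DifferentiableOn ℂ f (ball 0 1)) (r : ℝ)
    (h0 : 0 ≤ r) (h1 : r < 1) : C(UnitAddCircle, ℂ) where
  toFun t := f (r * fourier 1 t)
  continuous_toFun := by
    refine hf.continuousOn.comp_continuous (by fun_prop) ?_
    intro t
    exact hs_mem h0 h1 t

theorem hs_four (n : ℕ) (t : UnitAddCircle) : fourier (n : ℤ) t = (fourier 1 t) ^ n := by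
  induction n with
  | zero => simp
  | succ n ih => push_cast; rw [fourier_add, ih, pow_succ]

theorem hs_hasSum (f : ℂ → ℂ) (hf : DifferentiableOn ℂ f (ball 0 1)) (r : ℝ)
    (h0 : 0 ≤ r) (h1 : r < 1) :
    HasSum (fun n : ℕ => (hcoeff f n * r ^ n) • (fourier (n : ℤ) : C(UnitAddCircle, ℂ)))
      (hs_circ f hf r h0 h1) := by
  have hr : (r : ℂ) ∈ ball (0 : ℂ) 1 := by simp [abs_of_nonneg h0, h1]
  have hs : Summable (fun n : ℕ =>
      (hcoeff f n * r ^ n) • (fourier (n : ℤ) : C(UnitAddCircle, ℂ))) := by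
    apply Summable.of_norm
    have := (hs_sum hf hr).summable.norm
    convert this using 2 with n
    rw [norm_smul, fourier_norm, mul_one]
  convert hs.hasSum
  ext t
  rw [← ContinuousMap.tsum_apply hs]
  have ht : (r * fourier 1 t : ℂ) ∈ ball (0 : ℂ) 1 := hs_mem h0 h1 t
  rw [show hs_circ f hf r h0 h1 t = f (r * fourier 1 t) from rfl, ← (hs_sum hf ht).tsum_eq]
  congr 1
  ext n
  rw [ContinuousMap.smul_apply, hs_four, smul_eq_mul, mul_pow, mul_assoc]

theorem hs_parseval (f : ℂ → ℂ) (hf : DifferentiableOn ℂ f (ball 0 1)) (r : ℝ)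
    (h0 : 0 ≤ r) (h1 : r < 1) :
    HasSum (fun n : ℕ => ‖hcoeff f n * r ^ n‖ ^ 2)
      (‖ContinuousMap.toLp (E := ℂ) 2 AddCircle.haarAddCircle ℂ (hs_circ f hf r h0 h1)‖ ^ 2) := by
  have he : Orthonormal ℂ (fun n : ℕ => (fourierLp 2 (n : ℤ) :
      Lp ℂ 2 (AddCircle.haarAddCircle (T := 1)))) :=
    orthonormal_fourier.comp _ Nat.cast_injective
  refine hs_orth he ?_
  have := (hs_hasSum f hf r h0 h1).mapL
    (ContinuousMap.toLp (E := ℂ) 2 AddCircle.haarAddCircle ℂ)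
  simpa only [map_smul] using this

theorem hs_mul {g k : ℂ → ℂ} (hg : DifferentiableOn ℂ g (ball 0 1))
    {M : ℝ} (hM : ∀ z ∈ ball (0 : ℂ) 1, ‖g z‖ ≤ M) (hk : MemH2 k) :
    MemH2 (fun z => g z * k z) := by
  have hd : DifferentiableOn ℂ (fun z => g z * k z) (ball 0 1) := hg.mul hk.1
  refine ⟨hd, ?_⟩
  have key : ∀ r : ℝ, 0 ≤ r → r < 1 → ∀ N : ℕ,
      ∑ n ∈ Finset.range N, ‖hcoeff (fun z => g z * k z) n * r ^ n‖ ^ 2 ≤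
        M ^ 2 * hnormSq k := by
    intro r h0 h1 N
    have p1 := hs_parseval _ hd r h0 h1
    have p2 := hs_parseval _ hk.1 r h0 h1
    refine (p1.summable.sum_le_tsum _ (fun _ _ => by positivity)).trans ?_
    rw [p1.tsum_eq]
    have hle : ‖ContinuousMap.toLp (E := ℂ) 2 AddCircle.haarAddCircle ℂ
        (hs_circ _ hd r h0 h1)‖ ≤ M * ‖ContinuousMap.toLp (E := ℂ) 2 AddCircle.haarAddCircle ℂ
        (hs_circ k hk.1 r h0 h1)‖ := by
      apply Lp.norm_le_mul_norm_of_ae_le_mul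
      filter_upwards [ContinuousMap.coeFn_toLp (p := 2) (𝕜 := ℂ) AddCircle.haarAddCircle
        (hs_circ _ hd r h0 h1), ContinuousMap.coeFn_toLp (p := 2) (𝕜 := ℂ) AddCircle.haarAddCircle
        (hs_circ k hk.1 r h0 h1)] with t e1 e2
      rw [e1, e2]
      have ht : (r * fourier 1 t : ℂ) ∈ ball (0 : ℂ) 1 := hs_mem h0 h1 t
      change ‖g (r * fourier 1 t) * k (r * fourier 1 t)‖ ≤ M * ‖k (r * fourier 1 t)‖
      rw [norm_mul]
      exact mul_le_mul_of_nonneg_right (hM _ ht) (norm_nonneg _)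
    calc _ ≤ (M * ‖ContinuousMap.toLp (E := ℂ) 2 AddCircle.haarAddCircle ℂ
        (hs_circ k hk.1 r h0 h1)‖) ^ 2 := by gcongr
      _ = M ^ 2 * ∑' n, ‖hcoeff k n * r ^ n‖ ^ 2 := by rw [mul_pow, p2.tsum_eq]
      _ ≤ M ^ 2 * hnormSq k := by
        apply mul_le_mul_of_nonneg_left _ (sq_nonneg M)
        refine p2.summable.tsum_le_tsum (fun n => ?_) hk.2
        have : ‖hcoeff k n * r ^ n‖ ≤ ‖hcoeff k n‖ := by
          rw [norm_mul]
          apply mul_le_of_le_one_right (norm_nonneg _)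
          simp only [norm_pow, Complex.norm_real, Real.norm_eq_abs, abs_of_nonneg h0]
          exact pow_le_one₀ h0 h1.le
        gcongr
  refine summable_of_sum_range_le (c := M ^ 2 * hnormSq k) (fun n => by positivity) (fun N => ?_)
  have hc : Continuous fun r : ℝ =>
      ∑ n ∈ Finset.range N, ‖hcoeff (fun z => g z * k z) n * (r : ℂ) ^ n‖ ^ 2 := by fun_prop
  have ht : Filter.Tendsto (fun r : ℝ =>
      ∑ n ∈ Finset.range N, ‖hcoeff (fun z => g z * k z) n * (r : ℂ) ^ n‖ ^ 2)
      (nhdsWithin 1 (Iio 1)) (nhds (∑ n ∈ Finset.range N,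
        ‖hcoeff (fun z => g z * k z) n‖ ^ 2)) := by
    have := (hc.tendsto 1).mono_left (nhdsWithin_le_nhds (s := Iio 1))
    simpa using this
  refine le_of_tendsto ht ?_
  filter_upwards [Ioo_mem_nhdsLT (zero_lt_one' ℝ)] with r hr
  exact key r hr.1.le hr.2 N

theorem hs_dslope {f : ℂ → ℂ} (hf : AnalyticAt ℂ f 0) (n : ℕ) :
    hcoeff (dslope f 0) n = hcoeff f (n + 1) := by
  have h1 := hf.hasFPowerSeriesAt.has_fpower_series_dslope_fslope
  have h2 := h1.analyticAt.hasFPowerSeriesAt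
  have h3 := h2.eq_formalMultilinearSeries h1
  have h4 := congrArg (fun p => FormalMultilinearSeries.coeff p n) h3
  simpa [FormalMultilinearSeries.coeff_ofScalars, hcoeff] using h4

theorem hs_zero (f : ℂ → ℂ) : hcoeff f 0 = f 0 := by simp [hcoeff]

theorem hs_sub {f g : ℂ → ℂ} (hf : AnalyticAt ℂ f 0) (hg : AnalyticAt ℂ g 0) (n : ℕ) :
    hcoeff (fun z => f z - g z) n = hcoeff f n - hcoeff g n := by
  have := iteratedDeriv_fun_sub (n := n) hf.contDiffAt hg.contDiffAt
  rw [hcoeff, this, sub_div]; rfl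

theorem hs_cmul (c : ℂ) (f : ℂ → ℂ) (n : ℕ) :
    hcoeff (fun z => c * f z) n = c * hcoeff f n := by
  rw [hcoeff, iteratedDeriv_const_mul_field, mul_div_assoc]; rfl

theorem hs_H2_dslope {f : ℂ → ℂ} (hf : MemH2 f) : MemH2 (dslope f 0) := by
  refine ⟨(differentiableOn_dslope (isOpen_ball.mem_nhds (mem_ball_self one_pos))).2 hf.1, ?_⟩
  simp_rw [hs_dslope (hs_an hf.1)]
  exact (summable_nat_add_iff 1).2 hf.2

theorem hs_H2_sub {f g : ℂ → ℂ} (hf : MemH2 f) (hg : MemH2 g) (c : ℂ) :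
    MemH2 (fun z => f z - c * g z) := by
  refine ⟨hf.1.sub (hg.1.const_mul c), ?_⟩
  refine Summable.of_nonneg_of_le (fun n => by positivity) (fun n => ?_)
    ((hf.2.mul_left 2).add (hg.2.mul_left (2 * ‖c‖ ^ 2)))
  rw [hs_sub (hs_an hf.1) (hs_an (hg.1.const_mul c)), hs_cmul]
  have := norm_sub_le (hcoeff f n) (c * hcoeff g n)
  rw [norm_mul] at this
  calc _ ≤ (‖hcoeff f n‖ + ‖c‖ * ‖hcoeff g n‖) ^ 2 := by gcongr
    _ ≤ _ := by nlinarith [sq_nonneg (‖hcoeff f n‖ - ‖c‖ * ‖hcoeff g n‖)]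

theorem hs_norm_sub {f g : ℂ → ℂ} (hf : MemH2 f) (hg : MemH2 g) (c : ℂ) :
    hnormSq (fun z => f z - c * g z) ≤ 2 * hnormSq f + 2 * ‖c‖ ^ 2 * hnormSq g := by
  unfold hnormSq
  rw [← tsum_mul_left, ← tsum_mul_left,
    ← (hf.2.mul_left 2).tsum_add (hg.2.mul_left (2 * ‖c‖ ^ 2))]
  refine (hs_H2_sub hf hg c).2.tsum_le_tsum (fun n => ?_)
    ((hf.2.mul_left 2).add (hg.2.mul_left (2 * ‖c‖ ^ 2)))
  rw [hs_sub (hs_an hf.1) (hs_an (hg.1.const_mul c)), hs_cmul]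
  have := norm_sub_le (hcoeff f n) (c * hcoeff g n)
  rw [norm_mul] at this
  calc _ ≤ (‖hcoeff f n‖ + ‖c‖ * ‖hcoeff g n‖) ^ 2 := by gcongr
    _ ≤ _ := by nlinarith [sq_nonneg (‖hcoeff f n‖ - ‖c‖ * ‖hcoeff g n‖)]

theorem hs_inner_summable {f g : ℂ → ℂ} (hf : MemH2 f) (hg : MemH2 g) :
    Summable fun n : ℕ => (starRingEnd ℂ) (hcoeff f n) * hcoeff g n := by
  apply Summable.of_norm
  refine Summable.of_nonneg_of_le (fun n => by positivity) (fun n => ?_) (hf.2.add hg.2)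
  rw [norm_mul, RCLike.norm_conj]
  nlinarith [sq_nonneg (‖hcoeff f n‖ - ‖hcoeff g n‖), sq_nonneg ‖hcoeff f n‖,
    sq_nonneg ‖hcoeff g n‖]

theorem hs_K_sub {θ k h : ℂ → ℂ} (hθ : IsInner θ) (hk : MemK θ k) (hh : MemK θ h) (c : ℂ) :
    MemK θ (fun z => k z - c * h z) := by
  refine ⟨hs_H2_sub hk.1 hh.1 c, fun u hu => ?_⟩
  have hm := hs_mul hθ.1 hθ.2.1 hu
  have e1 := hk.2 u hu
  have e2 := hh.2 u hu
  unfold hinner at *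
  have : (fun n : ℕ => (starRingEnd ℂ) (hcoeff (fun z => θ z * u z) n) *
      hcoeff (fun z => k z - c * h z) n) = fun n =>
      (starRingEnd ℂ) (hcoeff (fun z => θ z * u z) n) * hcoeff k n -
      c * ((starRingEnd ℂ) (hcoeff (fun z => θ z * u z) n) * hcoeff h n) := by
    ext n
    rw [hs_sub (hs_an hk.1.1) (hs_an (hh.1.1.const_mul c)), hs_cmul]
    ring
  rw [this, (hs_inner_summable hm hk.1).tsum_sub ((hs_inner_summable hm hh.1).mul_left c),
    tsum_mul_left, e1, e2]
  simp

theorem hs_shift {u : ℂ → ℂ} (hu : DifferentiableOn ℂ u (ball 0 1)) (n : ℕ) :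
    hcoeff (fun z => z * u z) (n + 1) = hcoeff u n := by
  have hd : DifferentiableOn ℂ (fun z => z * u z) (ball 0 1) := differentiableOn_id.mul hu
  rw [← hs_dslope (hs_an hd)]
  congr 1
  ext z
  by_cases hz : z = 0
  · subst hz
    rw [dslope_same]
    have := (hasDerivAt_id (0 : ℂ)).mul (hs_an hu).differentiableAt.hasDerivAt
    simpa using! this.deriv
  · rw [dslope_of_ne _ hz, slope_def_field]
    field_simp
    simp [mul_comm]

theorem hs_K_dslope {θ k : ℂ → ℂ} (hθ : IsInner θ) (hk : MemK θ k) : MemK θ (dslope k 0) := by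
  refine ⟨hs_H2_dslope hk.1, fun u hu => ?_⟩
  have hm := hs_mul hθ.1 hθ.2.1 hu
  have hzu : MemH2 (fun z => z * u z) := by
    refine ⟨differentiableOn_id.mul hu.1, ?_⟩
    rw [← summable_nat_add_iff 1]
    simp_rw [hs_shift hu.1]
    exact hu.2
  have e := hk.2 _ hzu
  have hm2 := hs_mul hθ.1 hθ.2.1 hzu
  unfold hinner at *
  rw [(hs_inner_summable hm2 hk.1).tsum_eq_zero_add] at e
  have hfun : (fun z => θ z * (z * u z)) = fun z => z * (θ z * u z) := by ext z; ring
  rw [hfun] at e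
  simp_rw [hs_shift hm.1] at e
  simp_rw [hs_dslope (hs_an hk.1.1)]
  simpa [hs_zero] using e

/-- For g ∈ H^∞(𝔻) with g(0) ≠ 0 and θ a non-constant inner function, the closure of
g·K_θ in H²(𝔻) is nearly S*-invariant: if f is in the closure of gK_θ and f(0) = 0, then
S*f = f/z lies in the closure of gK_θ. -/
theorem stmt15 (g θ : ℂ → ℂ)
    (hg_an : DifferentiableOn ℂ g (ball 0 1)) (hg_bdd : ∃ M, ∀ z ∈ ball (0 : ℂ) 1, ‖g z‖ ≤ M)
    (hg0 : g 0 ≠ 0)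
    (hθ : IsInner θ) (hθnc : ¬ ∃ c : ℂ, ∀ z ∈ ball (0 : ℂ) 1, θ z = c)
    (f : ℂ → ℂ) (hfH2 : MemH2 f)
    (hfclos : ∀ ε > (0 : ℝ), ∃ k, MemK θ k ∧ hnormSq (fun z => f z - g z * k z) < ε)
    (hf0 : f 0 = 0) :
    MemH2 (fun z => if z = 0 then deriv f 0 else f z / z) ∧
    ∀ ε > (0 : ℝ), ∃ k, MemK θ k ∧
      hnormSq (fun z => (if z = 0 then deriv f 0 else f z / z) - g z * k z) < ε := by
  obtain ⟨M, hM⟩ := hg_bdd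
  have hS : ∀ z, (if z = 0 then deriv f 0 else f z / z) = dslope f 0 z := by
    intro z
    by_cases hz : z = 0
    · simp [hz]
    · simp [hz, dslope_of_ne, slope_def_field, hf0]
  simp_rw [hS]
  refine ⟨hs_H2_dslope hfH2, ?_⟩
  have hgk : ∀ k, MemH2 k → MemH2 (fun z => f z - g z * k z) := by
    intro k hk
    simpa using hs_H2_sub hfH2 (hs_mul hg_an hM hk) 1
  -- approximants vanishing at the origin
  have step : ∃ C : ℝ, 0 < C ∧ ∀ k, MemK θ k → ∃ k', MemK θ k' ∧ k' 0 = 0 ∧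
      hnormSq (fun z => f z - g z * k' z) ≤ C * hnormSq (fun z => f z - g z * k z) := by
    by_cases hex : ∃ h, MemK θ h ∧ h 0 ≠ 0
    · obtain ⟨h, hh, hh0⟩ := hex
      have hgh := hs_mul hg_an hM hh.1
      have hN : 0 ≤ hnormSq (fun z => g z * h z) := tsum_nonneg fun _ => by positivity
      have hp : 0 < ‖g 0 * h 0‖ := norm_pos_iff.2 (mul_ne_zero hg0 hh0)
      refine ⟨2 + 2 * (hnormSq (fun z => g z * h z) / ‖g 0 * h 0‖ ^ 2), by positivity,
        fun k hk => ?_⟩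
      refine ⟨fun z => k z - (k 0 / h 0) * h z, hs_K_sub hθ hk hh _, by field_simp; simp, ?_⟩
      have hF := hgk k hk.1
      have e := hs_norm_sub hF hgh (-(k 0 / h 0))
      have e0 : ‖g 0 * k 0‖ ^ 2 ≤ hnormSq (fun z => f z - g z * k z) := by
        have := hF.2.le_tsum 0 (fun _ _ => by positivity)
        rw [hs_zero] at this
        simpa [hf0, hnormSq] using this
      have e1 : ‖-(k 0 / h 0)‖ ^ 2 = ‖g 0 * k 0‖ ^ 2 / ‖g 0 * h 0‖ ^ 2 := by
        rw [norm_neg, ← div_pow, ← norm_div]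
        congr 2
        field_simp
      have e2 : (fun z => f z - g z * (k z - (k 0 / h 0) * h z)) =
          fun z => f z - g z * k z - -(k 0 / h 0) * (g z * h z) := by ext z; ring
      rw [e2]
      refine e.trans ?_
      rw [e1]
      have e3 : ‖g 0 * k 0‖ ^ 2 * (hnormSq (fun z => g z * h z) / ‖g 0 * h 0‖ ^ 2) ≤
          hnormSq (fun z => f z - g z * k z) *
            (hnormSq (fun z => g z * h z) / ‖g 0 * h 0‖ ^ 2) :=
        mul_le_mul_of_nonneg_right e0 (by positivity)
      have e4 : 2 * (‖g 0 * k 0‖ ^ 2 / ‖g 0 * h 0‖ ^ 2) * hnormSq (fun z => g z * h z) =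
        2 * (‖g 0 * k 0‖ ^ 2 * (hnormSq (fun z => g z * h z) / ‖g 0 * h 0‖ ^ 2)) := by ring
      rw [e4]
      linarith
    · push Not at hex
      exact ⟨1, one_pos, fun k hk => ⟨k, hk, hex k hk, by simp⟩⟩
  obtain ⟨C, hC, hstep⟩ := step
  intro ε hε
  obtain ⟨k, hk, hkε⟩ := hfclos (ε / C) (by positivity)
  obtain ⟨k', hk', hk'0, hle⟩ := hstep k hk
  refine ⟨dslope k' 0, hs_K_dslope hθ hk', ?_⟩
  have hF := hgk k' hk'.1
  have hfun : (fun z => dslope f 0 z - g z * dslope k' 0 z) =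
      dslope (fun z => f z - g z * k' z) 0 := by
    ext z
    by_cases hz : z = 0
    · subst hz
      simp only [dslope_same]
      have d := (hs_an hfH2.1).differentiableAt.hasDerivAt.sub
        ((hs_an hg_an).differentiableAt.hasDerivAt.mul
          (hs_an hk'.1.1).differentiableAt.hasDerivAt)
      have d' : deriv (fun z => f z - g z * k' z) 0 = _ := d.deriv
      rw [d', hk'0]
      ring
    · simp only [dslope_of_ne _ hz, slope_def_field, hf0, hk'0]
      ring
  rw [hfun]
  have hle2 : hnormSq (dslope (fun z => f z - g z * k' z) 0) ≤
      hnormSq (fun z => f z - g z * k' z) := by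
    unfold hnormSq
    rw [hF.2.tsum_eq_zero_add]
    simp_rw [hs_dslope (hs_an hF.1)]
    have := sq_nonneg ‖hcoeff (fun z => f z - g z * k' z) 0‖
    linarith
  have : C * hnormSq (fun z => f z - g z * k z) < ε := by
    rw [lt_div_iff₀ hC] at hkε
    linarith
  linarith
end

section
/- For δ > 0 and every nonnegative integer n, the closed linear span in H^2(𝔻) of the functions (1+z)^n·φ^λ(z) over 0 ≤ λ ≤ δ equals the model space K_{z^{n+1}φ^δ}. -/
open Complex MeasureTheory Metric Set

noncomputable section HardyAux

instance factTwoPi : Fact (0 < 2 * Real.pi) := ⟨Real.two_pi_pos⟩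

abbrev Cir := AddCircle (2 * Real.pi)

abbrev cmu : Measure Cir := AddCircle.haarAddCircle

/-- coordinate function on the circle -/
def ee (t : Cir) : ℂ := fourier 1 t

lemma ee_cont : Continuous ee := (fourier 1 : C(Cir, ℂ)).continuous

lemma ee_norm (t : Cir) : ‖ee t‖ = 1 := by
  unfold ee; rw [fourier_one]; exact Circle.norm_coe _

lemma ee_pow (k : ℕ) (t : Cir) : ee t ^ k = fourier (k : ℤ) t := by
  induction k with
  | zero => rw [pow_zero]; exact fourier_zero.symm
  | succ k ih => rw [pow_succ, ih]; push_cast; rw [fourier_add]; rfl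

lemma ee_conj (t : Cir) : (starRingEnd ℂ) (ee t) * ee t = 1 := by
  rw [mul_comm, Complex.mul_conj, Complex.normSq_eq_norm_sq, ee_norm]; simp

lemma cmu_singleton (t : Cir) : cmu {t} = 0 := by
  have hv : (volume : Measure Cir) {t} = 0 := by
    induction t using QuotientAddGroup.induction_on with
    | H x =>
    have hle : ∀ ε : ℝ, 0 < ε → (volume : Measure Cir) {(x : Cir)} ≤ ENNReal.ofReal (2 * ε) := by
      intro ε hε
      calc (volume : Measure Cir) {(x : Cir)} ≤ volume (closedBall (x : Cir) ε) :=
            measure_mono (by simpa using hε.le)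
        _ = ENNReal.ofReal (min (2 * Real.pi) (2 * ε)) := AddCircle.volume_closedBall _ _
        _ ≤ _ := ENNReal.ofReal_le_ofReal (min_le_right _ _)
    refine le_antisymm (ENNReal.le_of_forall_pos_le_add fun ε hε _ => ?_) zero_le
    refine (hle (ε / 2) (by positivity)).trans ?_
    rw [zero_add, mul_div_cancel₀ _ (by norm_num), ENNReal.ofReal_coe_nnreal]
  rw [AddCircle.volume_eq_smul_haarAddCircle] at hv
  simp only [Measure.smul_apply, smul_eq_mul, mul_eq_zero, ENNReal.ofReal_eq_zero] at hv
  rcases hv with hv | hv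
  · exact absurd hv (not_le.mpr Real.two_pi_pos)
  · exact hv

lemma ee_ae : ∀ᵐ t ∂cmu, 1 + ee t ≠ 0 := by
  by_cases h : ∃ s : Cir, 1 + ee s = 0
  · obtain ⟨s, hs⟩ := h
    have h0 : ∀ᵐ t ∂cmu, t ≠ s := by
      rw [ae_iff]
      simpa using cmu_singleton s
    filter_upwards [h0] with t ht h1
    apply ht
    apply AddCircle.injective_toCircle Real.two_pi_pos.ne'
    apply Subtype.ext
    have : ee t = ee s := by linear_combination h1 - hs
    simpa only [ee, fourier_one] using this
  · push Not at h
    exact Filter.Eventually.of_forall h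

lemma phi_cont_disc (lam : ℝ) (z : ℂ) (hz : 1 + z ≠ 0) : ContinuousAt (phi lam) z := by
  unfold phi
  have : ContinuousAt (fun z : ℂ => -(lam : ℂ) * (1 - z) / (1 + z)) z := by
    apply ContinuousAt.div (by fun_prop) (by fun_prop) hz
  exact Complex.continuous_exp.continuousAt.comp this

lemma phi_meas (lam : ℝ) : Measurable (phi lam) := by
  unfold phi
  fun_prop

lemma re_cayley (z : ℂ) (lam : ℝ) :
    (-(lam : ℂ) * (1 - z) / (1 + z)).re = -lam * (1 - ‖z‖ ^ 2) / ‖1 + z‖ ^ 2 := by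
  rw [Complex.div_re, ← Complex.normSq_eq_norm_sq, ← Complex.normSq_eq_norm_sq]
  simp [Complex.normSq_apply]
  ring

lemma phi_norm_circle (lam : ℝ) (t : Cir) : ‖phi lam (ee t)‖ = 1 := by
  unfold phi
  rw [Complex.norm_exp, re_cayley, ee_norm]; simp

lemma phi_norm_disc (lam : ℝ) (hl : 0 ≤ lam) (z : ℂ) (hz : ‖z‖ < 1) : ‖phi lam z‖ ≤ 1 := by
  unfold phi
  rw [Complex.norm_exp, re_cayley, Real.exp_le_one_iff]
  apply div_nonpos_of_nonpos_of_nonneg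
  · nlinarith [norm_nonneg z, mul_nonneg hl (by nlinarith [norm_nonneg z] : 0 ≤ 1 - ‖z‖ ^ 2)]
  · positivity

lemma phi_add (a b : ℝ) (z : ℂ) : phi (a + b) z = phi a z * phi b z := by
  unfold phi
  rw [← Complex.exp_add]; congr 1; push_cast; ring

lemma phi_zero (z : ℂ) : phi 0 z = 1 := by simp [phi]

lemma phi_conj (a : ℝ) (t : Cir) : (starRingEnd ℂ) (phi a (ee t)) * phi a (ee t) = 1 := by
  rw [mul_comm, Complex.mul_conj, Complex.normSq_eq_norm_sq, phi_norm_circle]; simp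

lemma phi_diff (lam : ℝ) : DifferentiableOn ℂ (phi lam) (ball 0 1) := by
  intro z hz
  have : 1 + z ≠ 0 := by
    intro h
    have : z = -1 := by linear_combination h
    simp [this] at hz
  unfold phi
  apply DifferentiableAt.differentiableWithinAt
  fun_prop (disch := assumption)

/-! ### The core argument -/

lemma J_deriv (w : Cir → ℂ) (hw : Integrable w cmu) (v : Cir → ℂ) (hv : Continuous v) (lam : ℝ) :
    HasDerivAt (fun l : ℝ => ∫ t, phi l (ee t) * ((1 + ee t) * v t) * w t ∂cmu)
      (∫ t, phi lam (ee t) * (-(1 - ee t) * v t) * w t ∂cmu) lam := by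
  obtain ⟨C, hC⟩ : ∃ C, ∀ t, ‖v t‖ ≤ C := by
    obtain ⟨C, hC⟩ := (isCompact_univ (X := Cir)).exists_bound_of_continuousOn hv.continuousOn
    exact ⟨C, fun t => hC t trivial⟩
  have hm : ∀ l : ℝ, Measurable fun t => phi l (ee t) := fun l =>
    (phi_meas l).comp ee_cont.measurable
  have hp : ∀ t, ‖1 + ee t‖ ≤ 2 := fun t => by
    have := norm_add_le 1 (ee t); rw [ee_norm] at this; norm_num at this; linarith
  have hp' : ∀ t, ‖1 - ee t‖ ≤ 2 := fun t => by
    have := norm_sub_le 1 (ee t); rw [ee_norm] at this; norm_num at this; linarith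
  have hc := ee_cont
  refine (hasDerivAt_integral_of_dominated_loc_of_deriv_le (s := univ)
    (bound := fun t => 2 * C * ‖w t‖) (F := fun (l : ℝ) t => phi l (ee t) * ((1 + ee t) * v t) * w t)
    (F' := fun (l : ℝ) t => phi l (ee t) * (-(1 - ee t) * v t) * w t)
    Filter.univ_mem ?_ ?_ ?_ ?_ ?_ ?_).2
  · refine Filter.Eventually.of_forall fun l => ?_
    exact (((hm l).mul ((by fun_prop : Continuous fun t => (1 + ee t) * v t).measurable)
      ).aestronglyMeasurable).mul hw.1
  · refine hw.bdd_mul (c := 2 * C) ?_ (Filter.Eventually.of_forall fun t => ?_)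
    · exact (((hm lam).mul ((by fun_prop : Continuous fun t => (1 + ee t) * v t).measurable)
      ).aestronglyMeasurable)
    · rw [norm_mul, phi_norm_circle, one_mul, norm_mul]
      exact mul_le_mul (hp t) (hC t) (norm_nonneg _) (by norm_num)
  · exact (((hm lam).mul ((by fun_prop : Continuous fun t => -(1 - ee t) * v t).measurable)
      ).aestronglyMeasurable).mul hw.1
  · refine Filter.Eventually.of_forall fun t l _ => ?_
    rw [norm_mul, norm_mul, phi_norm_circle, one_mul, norm_mul, norm_neg]
    exact mul_le_mul_of_nonneg_right (mul_le_mul (hp' t) (hC t) (norm_nonneg _) (by norm_num))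
      (norm_nonneg _)
  · exact hw.norm.const_mul _
  · filter_upwards [ee_ae] with t ht l _
    have h1 : HasDerivAt (fun l : ℝ => phi l (ee t))
        (phi l (ee t) * (-(1 - ee t) / (1 + ee t))) l := by
      unfold phi
      apply HasDerivAt.cexp
      have := (Complex.ofRealCLM.hasDerivAt (x := l)).mul_const (-(1 - ee t) / (1 + ee t))
      simp only [Complex.ofRealCLM_apply, Complex.ofReal_one, one_mul] at this
      refine this.congr_of_eventuallyEq (Filter.Eventually.of_forall fun l => ?_)
      simp only
      ring
    have := (h1.mul_const ((1 + ee t) * v t)).mul_const (w t)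
    refine this.congr_deriv ?_
    field_simp

lemma J_int (w : Cir → ℂ) (hw : Integrable w cmu) (v : Cir → ℂ) (hv : Continuous v) (lam : ℝ) :
    Integrable (fun t => phi lam (ee t) * v t * w t) cmu := by
  obtain ⟨C, hC⟩ : ∃ C, ∀ t, ‖v t‖ ≤ C := by
    obtain ⟨C, hC⟩ := (isCompact_univ (X := Cir)).exists_bound_of_continuousOn hv.continuousOn
    exact ⟨C, fun t => hC t trivial⟩
  have hm : Measurable fun t => phi lam (ee t) := (phi_meas lam).comp ee_cont.measurable
  refine hw.bdd_mul (c := C) ?_ (Filter.Eventually.of_forall fun t => ?_)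
  · exact (hm.mul hv.measurable).aestronglyMeasurable
  · rw [norm_mul, phi_norm_circle, one_mul]; exact hC t

/-- `Q δ w v`: the measure `w` annihilates `φ^λ v` for `0 ≤ λ ≤ δ`. -/
def QQ (δ : ℝ) (w v : Cir → ℂ) : Prop :=
  ∀ lam ∈ Icc 0 δ, ∫ t, phi lam (ee t) * v t * w t ∂cmu = 0

lemma QQ_step (δ : ℝ) (hδ : 0 < δ) (w : Cir → ℂ) (hw : Integrable w cmu) (v : Cir → ℂ)
    (hv : Continuous v) (h : QQ δ w (fun t => (1 + ee t) * v t)) :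
    QQ δ w v ∧ QQ δ w (fun t => ee t * v t) := by
  have hc := ee_cont
  have h2 : QQ δ w (fun t => -(1 - ee t) * v t) := by
    intro lam hl
    have h1 := (J_deriv w hw v hv lam).hasDerivWithinAt (s := Icc 0 δ)
    have h3 : HasDerivWithinAt (fun l : ℝ => ∫ t, phi l (ee t) * ((1 + ee t) * v t) * w t ∂cmu) 0
        (Icc 0 δ) lam :=
      (hasDerivWithinAt_const lam (Icc 0 δ) (0 : ℂ)).congr (fun l hl => h l hl) (h lam hl)
    exact (uniqueDiffOn_Icc hδ lam hl).eq_deriv _ h1 h3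
  constructor
  · intro lam hl
    have a := h lam hl
    have b := h2 lam hl
    have i1 := J_int w hw (fun t => (1 + ee t) * v t) (by fun_prop) lam
    have i2 := J_int w hw (fun t => -(1 - ee t) * v t) (by fun_prop) lam
    have := integral_sub i1 i2
    rw [a, b] at this
    have e : (fun t => phi lam (ee t) * ((1 + ee t) * v t) * w t
        - phi lam (ee t) * (-(1 - ee t) * v t) * w t)
        = fun t => 2 * (phi lam (ee t) * v t * w t) := by
      ext t; ring
    rw [e, integral_const_mul] at this
    simpa using this
  · intro lam hl
    have a := h lam hl
    have b := h2 lam hl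
    have i1 := J_int w hw (fun t => (1 + ee t) * v t) (by fun_prop) lam
    have i2 := J_int w hw (fun t => -(1 - ee t) * v t) (by fun_prop) lam
    have := integral_add i1 i2
    rw [a, b] at this
    have e : (fun t => phi lam (ee t) * ((1 + ee t) * v t) * w t
        + phi lam (ee t) * (-(1 - ee t) * v t) * w t)
        = fun t => 2 * (phi lam (ee t) * (ee t * v t) * w t) := by
      ext t; ring
    rw [e, integral_const_mul] at this
    simpa using this

lemma QQ_all (δ : ℝ) (hδ : 0 < δ) (w : Cir → ℂ) (hw : Integrable w cmu) (m : ℕ) :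
    ∀ (v : Cir → ℂ), Continuous v → QQ δ w (fun t => (1 + ee t) ^ m * v t) →
    ∀ a ≤ m, QQ δ w (fun t => ee t ^ a * v t) := by
  have hc := ee_cont
  induction m with
  | zero =>
    intro v hv h a ha
    obtain rfl : a = 0 := by omega
    simpa using h
  | succ m ih =>
    intro v hv h a ha
    have h' : QQ δ w (fun t => (1 + ee t) * ((1 + ee t) ^ m * v t)) := by
      convert h using 2; ring
    obtain ⟨h1, h2⟩ := QQ_step δ hδ w hw _ (by fun_prop) h'
    rcases a with _ | a
    · exact ih v hv h1 0 (by omega)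
    · have h3 : QQ δ w (fun t => (1 + ee t) ^ m * (ee t * v t)) := by
        convert h2 using 2; ring
      have := ih (fun t => ee t * v t) (by fun_prop) h3 a (by omega)
      convert this using 2; ring

lemma QQ_up (δ : ℝ) (w : Cir → ℂ) (hw : Integrable w cmu) (v : Cir → ℂ)
    (hv : Continuous v) (h : QQ δ w v)
    (hd : ∫ t, phi δ (ee t) * (ee t * v t) * w t ∂cmu = 0) : QQ δ w (fun t => ee t * v t) := by
  have hc := ee_cont
  set H : ℝ → ℂ := fun l : ℝ => ∫ t, phi l (ee t) * ((1 + ee t) * v t) * w t ∂cmu with hH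
  have hHe : ∀ lam ∈ Icc 0 δ, H lam = ∫ t, phi lam (ee t) * (ee t * v t) * w t ∂cmu := by
    intro lam hl
    have i1 := J_int w hw v hv lam
    have i2 := J_int w hw (fun t => ee t * v t) (by fun_prop) lam
    have := integral_add i1 i2
    rw [h lam hl, zero_add] at this
    rw [← this]
    refine integral_congr_ae (Filter.Eventually.of_forall fun t => ?_)
    simp only
    ring
  have hder : ∀ lam ∈ Icc 0 δ, HasDerivAt H (H lam) lam := by
    intro lam hl
    have h1 := J_deriv w hw v hv lam
    refine h1.congr_deriv ?_
    have i1 := J_int w hw v hv lam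
    have i2 := J_int w hw (fun t => -(1 - ee t) * v t) (by fun_prop) lam
    have := integral_add (i1.const_mul 2) i2
    rw [integral_const_mul, h lam hl, mul_zero, zero_add] at this
    rw [← this]
    refine integral_congr_ae (Filter.Eventually.of_forall fun t => ?_)
    simp only
    ring
  have hG : ∀ lam ∈ Icc 0 δ, HasDerivAt (fun l : ℝ => Complex.exp (-(l : ℂ)) * H l) 0 lam := by
    intro lam hl
    have h1 : HasDerivAt (fun l : ℝ => Complex.exp (-(l : ℂ))) (Complex.exp (-(lam : ℂ)) * (-1)) lam := by
      apply HasDerivAt.cexp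
      have := (Complex.ofRealCLM.hasDerivAt (x := lam)).neg
      refine (this.congr_deriv (by simp)).congr_of_eventuallyEq
        (Filter.Eventually.of_forall fun l => ?_)
      simp
    refine (h1.mul (hder lam hl)).congr_deriv ?_
    ring
  have hconst := constant_of_has_deriv_right_zero (f := fun l : ℝ => Complex.exp (-(l : ℂ)) * H l)
    (a := 0) (b := δ) (fun l hl => (hG l hl).continuousAt.continuousWithinAt)
    (fun l hl => (hG l ⟨hl.1, hl.2.le⟩).hasDerivWithinAt)
  intro lam hl
  rw [← hHe lam hl]
  have h0 : 0 ≤ δ := hl.1.trans hl.2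
  have e1 := hconst lam hl
  have e2 := hconst δ ⟨h0, le_rfl⟩
  rw [← e2, hHe δ ⟨h0, le_rfl⟩, hd, mul_zero] at e1
  simpa using e1

lemma core (δ : ℝ) (hδ : 0 < δ) (n : ℕ) (w : Cir → ℂ) (hw : Integrable w cmu)
    (h1 : QQ δ w (fun t => (1 + ee t) ^ n))
    (h2 : ∀ k, n + 1 ≤ k → ∫ t, phi δ (ee t) * ee t ^ k * w t ∂cmu = 0) (k : ℕ) :
    ∫ t, ee t ^ k * w t ∂cmu = 0 := by
  have hc := ee_cont
  have h3 := QQ_all δ hδ w hw n (fun _ => 1) (by fun_prop) (by simpa using h1)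
  simp only [mul_one] at h3
  have h4 : ∀ k, ∫ t, phi δ (ee t) * ee t ^ k * w t ∂cmu = 0 := by
    intro k
    by_cases hk : k ≤ n
    · exact h3 k hk δ ⟨hδ.le, le_rfl⟩
    · exact h2 k (by omega)
  have h5 : ∀ k : ℕ, QQ δ w (fun t => ee t ^ k) := by
    intro k
    induction k with
    | zero => exact h3 0 (by omega)
    | succ k ih =>
      simp only [pow_succ']
      apply QQ_up δ w hw _ (by fun_prop) ih
      simpa only [pow_succ'] using h4 (k + 1)
  have := h5 k 0 ⟨le_rfl, hδ.le⟩
  simpa [phi_zero] using this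

end HardyAux

noncomputable section HardyAux2

/-- `F` is the boundary function of the Hardy space function `f`. -/
def Bd (f : ℂ → ℂ) (F : Cir → ℂ) : Prop :=
  DifferentiableOn ℂ f (ball 0 1) ∧ MemLp F 2 cmu ∧
    (∀ k : ℕ, fourierCoeff F (k : ℤ) = hcoeff f k) ∧
    ∀ k : ℕ, fourierCoeff F (Int.negSucc k) = 0

lemma ip_toLp {F G : Cir → ℂ} (hF : MemLp F 2 cmu) (hG : MemLp G 2 cmu) :
    inner ℂ (hF.toLp F) (hG.toLp G) = ∫ t, (starRingEnd ℂ) (F t) * G t ∂cmu := by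
  rw [MeasureTheory.L2.inner_def]
  refine integral_congr_ae ?_
  filter_upwards [hF.coeFn_toLp, hG.coeFn_toLp] with t h1 h2
  rw [h1, h2, RCLike.inner_apply']

lemma basis_toLp {F : Cir → ℂ} (hF : MemLp F 2 cmu) (k : ℤ) :
    inner ℂ ((fourierBasis : HilbertBasis ℤ ℂ (Lp ℂ 2 cmu)) k) (hF.toLp F) = fourierCoeff F k := by
  rw [← HilbertBasis.repr_apply_apply, fourierBasis_repr]
  rw [fourierCoeff_congr_ae hF.coeFn_toLp]

lemma parseval {F G : Cir → ℂ} (hF : MemLp F 2 cmu) (hG : MemLp G 2 cmu) :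
    HasSum (fun k : ℤ => (starRingEnd ℂ) (fourierCoeff F k) * fourierCoeff G k)
      (∫ t, (starRingEnd ℂ) (F t) * G t ∂cmu) := by
  rw [← ip_toLp hF hG]
  have h := (fourierBasis : HilbertBasis ℤ ℂ (Lp ℂ 2 cmu)).hasSum_inner_mul_inner
    (hF.toLp F) (hG.toLp G)
  refine (congrArg (fun a => HasSum a _) (funext fun k => ?_)).mp h
  symm
  rw [basis_toLp, ← basis_toLp hF, inner_conj_symm]

lemma Bd.parseval_nat {f g : ℂ → ℂ} {F G : Cir → ℂ} (hf : Bd f F) (hg : Bd g G) :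
    HasSum (fun k : ℕ => (starRingEnd ℂ) (hcoeff f k) * hcoeff g k)
      (∫ t, (starRingEnd ℂ) (F t) * G t ∂cmu) := by
  have h := parseval hf.2.1 hg.2.1
  have hi : Function.Injective (fun k : ℕ => (k : ℤ)) := fun a b h => by simpa using h
  rw [← hi.hasSum_iff] at h
  · convert h using 1
    ext k
    simp only [Function.comp]
    rw [hf.2.2.1, hg.2.2.1]
  · intro k hk
    rcases k with k | k
    · exact absurd ⟨k, rfl⟩ hk
    · rw [hg.2.2.2, mul_zero]

lemma Bd.hinner_eq {f g : ℂ → ℂ} {F G : Cir → ℂ} (hf : Bd f F) (hg : Bd g G) :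
    hinner f g = inner ℂ (hf.2.1.toLp F) (hg.2.1.toLp G) := by
  rw [ip_toLp]; exact (hf.parseval_nat hg).tsum_eq

lemma Bd.hasSum_norm {f : ℂ → ℂ} {F : Cir → ℂ} (hf : Bd f F) :
    HasSum (fun k : ℕ => ‖hcoeff f k‖ ^ 2) (‖hf.2.1.toLp F‖ ^ 2) := by
  have h := hf.parseval_nat hf
  rw [← ip_toLp hf.2.1 hf.2.1, inner_self_eq_norm_sq_to_K] at h
  have h2 := Complex.hasSum_re h
  convert h2 using 1
  · ext k
    rw [mul_comm, Complex.mul_conj, Complex.normSq_eq_norm_sq, Complex.ofReal_re]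
  · norm_cast

lemma Bd.hnormSq_eq {f : ℂ → ℂ} {F : Cir → ℂ} (hf : Bd f F) :
    hnormSq f = ‖hf.2.1.toLp F‖ ^ 2 := hf.hasSum_norm.tsum_eq

lemma Bd.memH2 {f : ℂ → ℂ} {F : Cir → ℂ} (hf : Bd f F) : MemH2 f :=
  ⟨hf.1, hf.hasSum_norm.summable⟩

lemma MemH2.exists_Bd {f : ℂ → ℂ} (hf : MemH2 f) : ∃ F, Bd f F := by
  let a : ℤ → ℂ := fun k => match k with
    | Int.ofNat k => hcoeff f k
    | Int.negSucc _ => 0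
  have hi : Function.Injective (fun k : ℕ => (k : ℤ)) := fun a b h => by simpa using h
  have ha : Memℓp a 2 := by
    rw [memℓp_gen_iff (by norm_num)]
    rw [← hi.summable_iff]
    · convert hf.2 using 1
      ext k
      simp [a]
    · intro k hk
      rcases k with k | k
      · exact absurd ⟨k, rfl⟩ hk
      · simp [a]
  let x : Lp ℂ 2 cmu := (fourierBasis : HilbertBasis ℤ ℂ (Lp ℂ 2 cmu)).repr.symm ⟨a, ha⟩
  have hx : ∀ k, fourierCoeff (x : Cir → ℂ) k = a k := by
    intro k
    rw [← fourierBasis_repr]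
    simp [x]
  exact ⟨x, hf.1, Lp.memLp x, fun k => hx k, fun k => hx (Int.negSucc k)⟩

lemma cda {f : ℂ → ℂ} (hf : DifferentiableOn ℂ f (ball 0 1)) (n : ℕ) : ContDiffAt ℂ n f 0 :=
  (hf.analyticAt (ball_mem_nhds 0 one_pos)).contDiffAt

lemma hcoeff_sub {f g : ℂ → ℂ} (hf : DifferentiableOn ℂ f (ball 0 1))
    (hg : DifferentiableOn ℂ g (ball 0 1)) (k : ℕ) :
    hcoeff (fun z => f z - g z) k = hcoeff f k - hcoeff g k := by
  unfold hcoeff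
  rw [iteratedDeriv_fun_sub (cda hf k) (cda hg k)]; ring

lemma hcoeff_add {f g : ℂ → ℂ} (hf : DifferentiableOn ℂ f (ball 0 1))
    (hg : DifferentiableOn ℂ g (ball 0 1)) (k : ℕ) :
    hcoeff (fun z => f z + g z) k = hcoeff f k + hcoeff g k := by
  unfold hcoeff
  rw [iteratedDeriv_fun_add (cda hf k) (cda hg k)]; ring

lemma hcoeff_const_mul (c : ℂ) (f : ℂ → ℂ) (k : ℕ) :
    hcoeff (fun z => c * f z) k = c * hcoeff f k := by
  unfold hcoeff
  rw [iteratedDeriv_const_mul_field]; ring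

lemma hcoeff_mul {f g : ℂ → ℂ} (hf : DifferentiableOn ℂ f (ball 0 1))
    (hg : DifferentiableOn ℂ g (ball 0 1)) (k : ℕ) :
    hcoeff (fun z => f z * g z) k = ∑ i ∈ Finset.range (k + 1), hcoeff f (k - i) * hcoeff g i := by
  have hc : (fun z => f z * g z) = fun z => g z * f z := by ext z; ring
  unfold hcoeff
  rw [hc, iteratedDeriv_fun_mul (cda hg k) (cda hf k), Finset.sum_div]
  refine Finset.sum_congr rfl fun i hi => ?_
  have hik : i ≤ k := by simpa [Nat.lt_succ_iff] using hi
  rw [Nat.cast_choose ℂ hik]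
  have h1 : (k.factorial : ℂ) ≠ 0 := by exact_mod_cast k.factorial_ne_zero
  have h2 : (i.factorial : ℂ) ≠ 0 := by exact_mod_cast i.factorial_ne_zero
  have h3 : ((k - i).factorial : ℂ) ≠ 0 := by exact_mod_cast (k - i).factorial_ne_zero
  field_simp

lemma fc_int {F : Cir → ℂ} (hF : MemLp F 2 cmu) : Integrable F cmu := hF.integrable (by norm_num)

lemma fc_add {F G : Cir → ℂ} (hF : MemLp F 2 cmu) (hG : MemLp G 2 cmu) (k : ℤ) :
    fourierCoeff (fun t => F t + G t) k = fourierCoeff F k + fourierCoeff G k := by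
  rw [← basis_toLp hF, ← basis_toLp hG, ← inner_add_right, ← MemLp.toLp_add hF hG, basis_toLp]
  rfl

lemma fc_const_mul (c : ℂ) (F : Cir → ℂ) (k : ℤ) :
    fourierCoeff (fun t => c * F t) k = c * fourierCoeff F k := fourierCoeff.const_mul F c k

lemma Bd.add {f g : ℂ → ℂ} {F G : Cir → ℂ} (hf : Bd f F) (hg : Bd g G) :
    Bd (fun z => f z + g z) (fun t => F t + G t) := by
  refine ⟨hf.1.add hg.1, hf.2.1.add hg.2.1, fun k => ?_, fun k => ?_⟩
  · rw [fc_add hf.2.1 hg.2.1, hcoeff_add hf.1 hg.1, hf.2.2.1, hg.2.2.1]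
  · rw [fc_add hf.2.1 hg.2.1, hf.2.2.2, hg.2.2.2, add_zero]

lemma Bd.const_mul (c : ℂ) {f : ℂ → ℂ} {F : Cir → ℂ} (hf : Bd f F) :
    Bd (fun z => c * f z) (fun t => c * F t) := by
  refine ⟨hf.1.const_mul c, hf.2.1.const_mul c, fun k => ?_, fun k => ?_⟩
  · rw [fc_const_mul, hcoeff_const_mul, hf.2.2.1]
  · rw [fc_const_mul, hf.2.2.2, mul_zero]

lemma Bd.sub {f g : ℂ → ℂ} {F G : Cir → ℂ} (hf : Bd f F) (hg : Bd g G) :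
    Bd (fun z => f z - g z) (fun t => F t - G t) := by
  have h := hf.add (hg.const_mul (-1))
  have e1 : (fun z => f z - g z) = fun z => f z + -1 * g z := by ext z; ring
  have e2 : (fun t => F t - G t) = fun t => F t + -1 * G t := by ext z; ring
  rw [e1, e2]; exact h

lemma MemLp.bmul {b G : Cir → ℂ} {C : ℝ} (hb : AEStronglyMeasurable b cmu) (hC : ∀ t, ‖b t‖ ≤ C)
    (hG : MemLp G 2 cmu) : MemLp (fun t => b t * G t) 2 cmu := by
  refine MemLp.of_le_mul (c := C) hG (hb.mul hG.1) (Filter.Eventually.of_forall fun t => ?_)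
  rw [norm_mul]
  exact mul_le_mul_of_nonneg_right (hC t) (norm_nonneg _)

lemma fourier_norm1 (k : ℤ) (t : Cir) : ‖(fourier k t : ℂ)‖ = 1 := Circle.norm_coe _

lemma fourier_memLp (k : ℤ) : MemLp (fun t : Cir => (fourier k t : ℂ)) 2 cmu :=
  MemLp.of_bound ((fourier k : C(Cir, ℂ)).continuous.aestronglyMeasurable) 1
    (Filter.Eventually.of_forall fun t => (fourier_norm1 k t).le)

lemma fc_mul {b G : Cir → ℂ} {C : ℝ} (hb : MemLp b 2 cmu) (hC : ∀ t, ‖b t‖ ≤ C)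
    (hG : MemLp G 2 cmu) (k : ℤ) :
    HasSum (fun j : ℤ => fourierCoeff b (k - j) * fourierCoeff G j)
      (fourierCoeff (fun t => b t * G t) k) := by
  have hm : MemLp (fun t => (starRingEnd ℂ) (b t) * (fourier k t : ℂ)) 2 cmu := by
    refine MemLp.bmul (C := C) ?_ ?_ (fourier_memLp k)
    · exact Complex.continuous_conj.comp_aestronglyMeasurable hb.1
    · intro t; simpa using hC t
  have h := parseval hm hG
  convert h using 1
  · ext j
    congr 1
    unfold fourierCoeff
    rw [← integral_conj]
    refine integral_congr_ae (Filter.Eventually.of_forall fun t => ?_)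
    simp only [smul_eq_mul, map_mul, Complex.conj_conj]
    rw [fourier_neg (n := j), Complex.conj_conj, ← fourier_neg, show -(k - j) = j + -k by ring,
      fourier_add]
    ring
  · unfold fourierCoeff
    refine integral_congr_ae (Filter.Eventually.of_forall fun t => ?_)
    simp only [smul_eq_mul, map_mul, Complex.conj_conj]
    rw [fourier_neg]; ring

lemma Bd.mul {m g : ℂ → ℂ} {b G : Cir → ℂ} {C : ℝ} (hm : Bd m b) (hC : ∀ t, ‖b t‖ ≤ C)
    (hg : Bd g G) : Bd (fun z => m z * g z) (fun t => b t * G t) := by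
  refine ⟨hm.1.mul hg.1, MemLp.bmul hm.2.1.1 hC hg.2.1, fun k => ?_, fun k => ?_⟩
  · have h := fc_mul hm.2.1 hC hg.2.1 k
    have hi : Function.Injective (fun k : ℕ => (k : ℤ)) := fun a b h => by simpa using h
    rw [← hi.hasSum_iff] at h
    · refine h.unique ?_
      rw [hcoeff_mul hm.1 hg.1]
      have : ∑ i ∈ Finset.range (k + 1), hcoeff m (k - i) * hcoeff g i =
          ∑ i ∈ Finset.range (k + 1), ((fun j : ℤ => fourierCoeff b (k - j) * fourierCoeff G j) ∘
            fun k : ℕ => (k : ℤ)) i := by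
        refine Finset.sum_congr rfl fun i hi => ?_
        have hik : i ≤ k := by simpa [Nat.lt_succ_iff] using hi
        simp only [Function.comp]
        rw [hg.2.2.1, ← hm.2.2.1, Nat.cast_sub hik]
      rw [this]
      apply hasSum_sum_of_ne_finset_zero
      intro i hi
      have hik : k < i := by simpa using hi
      simp only [Function.comp]
      obtain ⟨d, rfl⟩ : ∃ d, i = k + d + 1 := ⟨i - k - 1, by omega⟩
      have : (k : ℤ) - ((k + d + 1 : ℕ) : ℤ) = Int.negSucc d := by
        rw [Int.negSucc_eq]; push_cast; ring
      rw [this, hm.2.2.2, zero_mul]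
    · intro j hj
      rcases j with j | j
      · exact absurd ⟨j, rfl⟩ hj
      · rw [hg.2.2.2, mul_zero]
  · have h := fc_mul hm.2.1 hC hg.2.1 (Int.negSucc k)
    refine h.unique ?_
    convert hasSum_zero using 1
    ext j
    rcases j with j | j
    · have : Int.negSucc k - Int.ofNat j = Int.negSucc (k + j) := by
        rw [Int.negSucc_eq, Int.negSucc_eq]; push_cast; simp; ring
      rw [this, hm.2.2.2, zero_mul]
    · rw [hg.2.2.2, mul_zero]

lemma four_circ (x r : ℝ) : (r : ℂ) * ee (x : Cir) = circleMap 0 r x := by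
  unfold ee
  rw [fourier_coe_apply, circleMap]
  have : (Real.pi : ℂ) ≠ 0 := by exact_mod_cast Real.pi_ne_zero
  rw [zero_add]; congr 2; push_cast; field_simp

lemma radial_pos {f : ℂ → ℂ} (hf : DifferentiableOn ℂ f (ball 0 1)) {r : ℝ} (hr0 : 0 < r)
    (hr1 : r < 1) (k : ℕ) :
    fourierCoeff (fun t : Cir => f (r * ee t)) (k : ℤ) = r ^ k * hcoeff f k := by
  have hsub : closedBall (0 : ℂ) r ⊆ ball 0 1 := closedBall_subset_ball hr1
  have h := circleIntegral_one_div_sub_center_pow_smul_of_differentiable_on_off_countable (c := 0)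
    (f := f) hr0 k countable_empty (hf.continuousOn.mono hsub)
    (fun z hz => hf.differentiableAt (isOpen_ball.mem_nhds (hsub (ball_subset_closedBall hz.1))))
  rw [fourierCoeff_eq_intervalIntegral _ _ 0, zero_add]
  have hr : (r : ℂ) ≠ 0 := by exact_mod_cast hr0.ne'
  have hpi : (Real.pi : ℂ) ≠ 0 := by exact_mod_cast Real.pi_ne_zero
  have e : ∀ x : ℝ, (fourier (-(k : ℤ)) (x : Cir) : ℂ) • f (r * ee (x : Cir)) =
      (r ^ k / I) * (deriv (circleMap 0 r) x • (1 / (circleMap 0 r x - 0) ^ (k + 1)) •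
        f (circleMap 0 r x)) := by
    intro x
    have hne : ee (x : Cir) ≠ 0 := by
      intro h; have := ee_norm (x : Cir); simp [h] at this
    have hfk : (fourier (-(k : ℤ)) (x : Cir) : ℂ) = (ee (x : Cir) ^ k)⁻¹ := by
      apply eq_inv_of_mul_eq_one_left
      rw [ee_pow, ← fourier_add]; simp
    rw [deriv_circleMap, ← four_circ, hfk]
    simp only [smul_eq_mul, sub_zero]
    field_simp
    ring
  simp_rw [e]
  rw [intervalIntegral.integral_const_mul]
  unfold circleIntegral at h
  rw [h, hcoeff]
  simp only [smul_eq_mul, Complex.real_smul]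
  push_cast
  field_simp

lemma radial_neg {f : ℂ → ℂ} (hf : DifferentiableOn ℂ f (ball 0 1)) {r : ℝ} (hr0 : 0 < r)
    (hr1 : r < 1) (k : ℕ) :
    fourierCoeff (fun t : Cir => f (r * ee t)) (Int.negSucc k) = 0 := by
  have hsub : closedBall (0 : ℂ) r ⊆ ball 0 1 := closedBall_subset_ball hr1
  have hf' : DifferentiableOn ℂ (fun z => z ^ k * f z) (ball 0 1) :=
    (differentiableOn_id.pow k).mul hf
  have h := circleIntegral_eq_zero_of_differentiable_on_off_countable (c := 0)
    (f := fun z => z ^ k * f z) hr0.le countable_empty (hf'.continuousOn.mono hsub)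
    (fun z hz => hf'.differentiableAt (isOpen_ball.mem_nhds (hsub (ball_subset_closedBall hz.1))))
  rw [fourierCoeff_eq_intervalIntegral _ _ 0, zero_add]
  have hr : (r : ℂ) ≠ 0 := by exact_mod_cast hr0.ne'
  have e : ∀ x : ℝ, (fourier (-(Int.negSucc k : ℤ)) (x : Cir) : ℂ) • f (r * ee (x : Cir)) =
      (1 / (r ^ (k + 1) * I)) * (deriv (circleMap 0 r) x • ((circleMap 0 r x) ^ k *
        f (circleMap 0 r x))) := by
    intro x
    have hfk : (fourier (-(Int.negSucc k : ℤ)) (x : Cir) : ℂ) = ee (x : Cir) ^ (k + 1) := by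
      rw [ee_pow]; rfl
    rw [deriv_circleMap, ← four_circ, hfk]
    simp only [smul_eq_mul]
    field_simp
    ring
  simp_rw [e]
  rw [intervalIntegral.integral_const_mul]
  unfold circleIntegral at h
  rw [h]
  simp

lemma Bd_of_bounded {f : ℂ → ℂ} (hf : DifferentiableOn ℂ f (ball 0 1)) (hm : Measurable f) {C : ℝ}
    (hC : ∀ z ∈ ball (0 : ℂ) 1, ‖f z‖ ≤ C) (hC' : ∀ t, ‖f (ee t)‖ ≤ C)
    (hc : ∀ z, 1 + z ≠ 0 → ContinuousAt f z) : Bd f (fun t => f (ee t)) := by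
  have hc' := ee_cont
  have key : ∀ k : ℤ, Filter.Tendsto (fun r : ℝ => fourierCoeff (fun t : Cir => f (r * ee t)) k)
      (nhdsWithin 1 (Iio 1)) (nhds (fourierCoeff (fun t => f (ee t)) k)) := by
    intro k
    unfold fourierCoeff
    refine tendsto_integral_filter_of_dominated_convergence (fun _ => C) ?_ ?_ ?_ ?_
    · refine Filter.Eventually.of_forall fun r => ?_
      exact ((fourier (-k) : C(Cir, ℂ)).continuous.measurable.mul
        (hm.comp (by fun_prop : Continuous fun t => (r : ℂ) * ee t).measurable)).aestronglyMeasurable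
    · have : Ioo (0 : ℝ) 1 ∈ nhdsWithin (1 : ℝ) (Iio 1) := Ioo_mem_nhdsLT one_pos
      filter_upwards [this] with r hr
      refine Filter.Eventually.of_forall fun t => ?_
      rw [norm_smul, fourier_norm1, one_mul]
      apply hC
      simp [ee_norm, abs_of_pos hr.1, hr.2]
    · exact integrable_const _
    · filter_upwards [ee_ae] with t ht
      refine Filter.Tendsto.const_smul ?_ _
      have h1 : Filter.Tendsto (fun r : ℝ => (r : ℂ) * ee t) (nhdsWithin 1 (Iio 1))
          (nhds (ee t)) := by
        have : Continuous fun r : ℝ => (r : ℂ) * ee t := by fun_prop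
        have := (this.tendsto 1).mono_left (nhdsWithin_le_nhds (s := Iio 1))
        simpa using this
      exact (hc _ ht).tendsto.comp h1
  have hIoo : Ioo (0 : ℝ) 1 ∈ nhdsWithin (1 : ℝ) (Iio 1) := Ioo_mem_nhdsLT one_pos
  refine ⟨hf, MemLp.of_bound (hm.comp hc'.measurable).aestronglyMeasurable C
    (Filter.Eventually.of_forall hC'), fun k => ?_, fun k => ?_⟩
  · refine tendsto_nhds_unique (key k) ?_
    have h1 : Filter.Tendsto (fun r : ℝ => (r : ℂ) ^ k * hcoeff f k) (nhdsWithin 1 (Iio 1))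
        (nhds (hcoeff f k)) := by
      have : Continuous fun r : ℝ => (r : ℂ) ^ k * hcoeff f k := by fun_prop
      have := (this.tendsto 1).mono_left (nhdsWithin_le_nhds (s := Iio 1))
      simpa using this
    refine h1.congr' ?_
    filter_upwards [hIoo] with r hr
    exact (radial_pos hf hr.1 hr.2 k).symm
  · refine tendsto_nhds_unique (key _) ?_
    refine (tendsto_const_nhds (x := (0 : ℂ))).congr' ?_
    filter_upwards [hIoo] with r hr
    exact (radial_neg hf hr.1 hr.2 k).symm

lemma Bd_basic (a n : ℕ) (lam : ℝ) (hl : 0 ≤ lam) :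
    Bd (fun z => z ^ a * ((1 + z) ^ n * phi lam z))
      (fun t => ee t ^ a * ((1 + ee t) ^ n * phi lam (ee t))) := by
  have hb : ∀ z : ℂ, ‖z‖ ≤ 1 → ‖phi lam z‖ ≤ 1 →
      ‖z ^ a * ((1 + z) ^ n * phi lam z)‖ ≤ 2 ^ n := by
    intro z h1 h2
    rw [norm_mul, norm_mul, norm_pow, norm_pow]
    have h3 : ‖1 + z‖ ≤ 2 := by
      have := norm_add_le 1 z; norm_num at this; linarith
    calc ‖z‖ ^ a * (‖1 + z‖ ^ n * ‖phi lam z‖) ≤ 1 * (2 ^ n * 1) := by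
          gcongr
          exact pow_le_one₀ (norm_nonneg _) h1
      _ = 2 ^ n := by ring
  refine Bd_of_bounded (f := fun z => z ^ a * ((1 + z) ^ n * phi lam z)) (C := 2 ^ n) ?_ ?_ ?_ ?_ ?_
  · exact (differentiableOn_id.pow a).mul
      (((differentiableOn_const 1).add differentiableOn_id).pow n |>.mul (phi_diff lam))
  · have := phi_meas lam
    fun_prop
  · intro z hz
    have hz' : ‖z‖ < 1 := by simpa using hz
    exact hb z hz'.le (phi_norm_disc lam hl z hz')
  · intro t
    exact hb _ (ee_norm t).le (phi_norm_circle lam t).le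
  · intro z hz
    have := phi_cont_disc lam z hz
    fun_prop

end HardyAux2

noncomputable section HardyAux3

lemma conj_mul_int {A v : Cir → ℂ} (hA : Integrable A cmu) (hv : Continuous v) :
    Integrable (fun t => (starRingEnd ℂ) (A t) * v t) cmu := by
  have h1 : Integrable (fun t => (starRingEnd ℂ) (A t)) cmu :=
    (Complex.conjCLE : ℂ →L[ℝ] ℂ).integrable_comp hA
  have := J_int _ h1 v hv 0
  simp only [phi_zero, one_mul] at this
  simpa only [mul_comm] using this

lemma Bd_eepow (a : ℕ) : Bd (fun z => z ^ a) (fun t => ee t ^ a) := by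
  simpa [phi_zero] using Bd_basic a 0 0 le_rfl

lemma Bd_phi (lam : ℝ) (hl : 0 ≤ lam) : Bd (fun z => phi lam z) (fun t => phi lam (ee t)) := by
  simpa using Bd_basic 0 0 lam hl

lemma Bd_V (n : ℕ) (lam : ℝ) (hl : 0 ≤ lam) :
    Bd (fun z => (1 + z) ^ n * phi lam z) (fun t => (1 + ee t) ^ n * phi lam (ee t)) := by
  simpa using Bd_basic 0 n lam hl

lemma eepow_norm (a : ℕ) (t : Cir) : ‖ee t ^ a‖ ≤ 1 := by
  rw [norm_pow, ee_norm, one_pow]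

lemma Bd_U (n : ℕ) (lam : ℝ) (hl : 0 ≤ lam) {g : ℂ → ℂ} {G : Cir → ℂ} (hg : Bd g G) :
    Bd (fun z => z ^ (n + 1) * phi lam z * g z) (fun t => ee t ^ (n + 1) * phi lam (ee t) * G t) := by
  have := (Bd_eepow (n + 1)).mul (eepow_norm _)
    ((Bd_phi lam hl).mul (fun t => (phi_norm_circle lam t).le) hg)
  simpa only [mul_assoc] using this

lemma orth (n : ℕ) : ∀ (h : ℂ → ℂ) (H : Cir → ℂ), Bd h H →
    ∫ t, (starRingEnd ℂ) (ee t ^ (n + 1) * H t) * (1 + ee t) ^ n ∂cmu = 0 := by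
  have hc := ee_cont
  induction n with
  | zero =>
    intro h H hB
    have h1 := hB.2.2.2 0
    unfold fourierCoeff at h1
    have h2 := congrArg (starRingEnd ℂ) h1
    rw [← integral_conj, map_zero] at h2
    rw [← h2]
    refine integral_congr_ae (Filter.Eventually.of_forall fun t => ?_)
    simp only [zero_add, pow_one, pow_zero, mul_one, smul_eq_mul]
    rfl
  | succ n ih =>
    intro h H hB
    have hB2 : Bd (fun z => z * h z) (fun t => ee t * H t) := by
      simpa using (Bd_eepow 1).mul (eepow_norm _) hB
    have i1 : Integrable (fun t => (starRingEnd ℂ) (ee t ^ (n + 1) * (ee t * H t))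
        * (1 + ee t) ^ n) cmu := by
      refine conj_mul_int ?_ (by fun_prop)
      exact fc_int ((Bd_eepow (n + 1)).mul (eepow_norm _) hB2).2.1
    have i2 : Integrable (fun t => (starRingEnd ℂ) (ee t ^ (n + 1) * H t)
        * (1 + ee t) ^ n) cmu := by
      refine conj_mul_int ?_ (by fun_prop)
      exact fc_int ((Bd_eepow (n + 1)).mul (eepow_norm _) hB).2.1
    have := integral_add i1 i2
    rw [ih _ _ hB2, ih _ _ hB, add_zero] at this
    rw [← this]
    refine integral_congr_ae (Filter.Eventually.of_forall fun t => ?_)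
    simp only [map_mul, map_pow]
    have := ee_conj t
    linear_combination ((starRingEnd ℂ) (ee t) ^ (n + 1) * (starRingEnd ℂ) (H t)
      * (1 + ee t) ^ n) * this

lemma orth2 (n : ℕ) (δ lam : ℝ) (hl : lam ∈ Icc 0 δ) {g : ℂ → ℂ} {G : Cir → ℂ} (hg : Bd g G) :
    ∫ t, (starRingEnd ℂ) (ee t ^ (n + 1) * phi δ (ee t) * G t) *
      ((1 + ee t) ^ n * phi lam (ee t)) ∂cmu = 0 := by
  have h1 := orth n _ _ ((Bd_phi (δ - lam) (by linarith [hl.2])).mul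
    (fun t => (phi_norm_circle _ t).le) hg)
  rw [← h1]
  refine integral_congr_ae (Filter.Eventually.of_forall fun t => ?_)
  have h2 : phi δ (ee t) = phi (δ - lam) (ee t) * phi lam (ee t) := by
    rw [← phi_add]; congr 1; ring
  simp only [h2, map_mul, map_pow]
  have := phi_conj lam t
  linear_combination ((starRingEnd ℂ) (ee t) ^ (n + 1) * (starRingEnd ℂ) (phi (δ - lam) (ee t)) *
    (starRingEnd ℂ) (G t) * (1 + ee t) ^ n) * this

lemma V_memLp (n : ℕ) (lam : ℝ) :
    MemLp (fun t => (1 + ee t) ^ n * phi lam (ee t)) 2 cmu := by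
  have hc := ee_cont
  refine MemLp.of_bound (C := 2 ^ n) ?_ (Filter.Eventually.of_forall fun t => ?_)
  · exact ((by fun_prop : Continuous fun t => (1 + ee t) ^ n).measurable.mul
      ((phi_meas lam).comp ee_cont.measurable)).aestronglyMeasurable
  · rw [norm_mul, phi_norm_circle, mul_one, norm_pow]
    have := norm_add_le 1 (ee t); rw [ee_norm] at this; norm_num at this
    gcongr

/-- The generating vectors in `L²` of the circle. -/
def VV (n : ℕ) (lam : ℝ) : Lp ℂ 2 cmu := (V_memLp n lam).toLp _

/-- Their linear span. -/
def MM (n : ℕ) (δ : ℝ) : Submodule ℂ (Lp ℂ 2 cmu) := Submodule.span ℂ (VV n '' Icc 0 δ)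

lemma Bd_sum (n m : ℕ) (c : Fin m → ℂ) (lam : Fin m → ℝ) (hl : ∀ i, 0 ≤ lam i)
    (s : Finset (Fin m)) :
    ∃ (F : Cir → ℂ) (h : Bd (fun z => ∑ i ∈ s, c i * ((1 + z) ^ n * phi (lam i) z)) F),
      h.2.1.toLp F = ∑ i ∈ s, c i • VV n (lam i) := by
  classical
  induction s using Finset.induction_on with
  | empty =>
    have h0 : Bd (fun z => ∑ i ∈ (∅ : Finset (Fin m)), c i * ((1 + z) ^ n * phi (lam i) z))
        (fun _ => 0) := by
      have := (Bd_eepow 0).const_mul 0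
      simpa using this
    exact ⟨_, h0, by simp⟩
  | insert i s hi ih =>
    obtain ⟨F, h, hF⟩ := ih
    have h1 := (Bd_V n (lam i) (hl i)).const_mul (c i)
    have h2 := h1.add h
    have e : (fun z => ∑ i ∈ insert i s, c i * ((1 + z) ^ n * phi (lam i) z)) =
        fun z => c i * ((1 + z) ^ n * phi (lam i) z) +
          ∑ i ∈ s, c i * ((1 + z) ^ n * phi (lam i) z) := by
      ext z; rw [Finset.sum_insert hi]
    refine ⟨_, e ▸ h2, ?_⟩
    rw [Finset.sum_insert hi, ← hF]
    have := MemLp.toLp_add h1.2.1 h.2.1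
    refine Eq.trans ?_ (this.trans ?_)
    · rfl
    · congr 1

lemma span_iff (n : ℕ) (δ : ℝ) {f : ℂ → ℂ} {F : Cir → ℂ} (hf : Bd f F) :
    InClosedSpan (fun lam z => (1 + z) ^ n * phi lam z) (Set.Icc 0 δ) f ↔
      hf.2.1.toLp F ∈ (MM n δ).topologicalClosure := by
  have key : ∀ (m : ℕ) (c : Fin m → ℂ) (lam : Fin m → ℝ), (∀ i, 0 ≤ lam i) →
      hnormSq (fun z => f z - ∑ i, c i * ((1 + z) ^ n * phi (lam i) z)) =
        ‖hf.2.1.toLp F - ∑ i, c i • VV n (lam i)‖ ^ 2 := by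
    intro m c lam hl
    obtain ⟨S, hS, e⟩ := Bd_sum n m c lam hl Finset.univ
    rw [← e, (hf.sub hS).hnormSq_eq, ← MemLp.toLp_sub hf.2.1 hS.2.1]
    rfl
  rw [← SetLike.mem_coe, Submodule.topologicalClosure_coe, Metric.mem_closure_iff]
  constructor
  · rintro ⟨-, h⟩ ε hε
    obtain ⟨m, c, lam, hl, hlt⟩ := h (ε ^ 2) (by positivity)
    refine ⟨∑ i, c i • VV n (lam i), ?_, ?_⟩
    · exact Submodule.sum_mem _ fun i _ => Submodule.smul_mem _ _
        (Submodule.subset_span ⟨lam i, hl i, rfl⟩)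
    · rw [key m c lam fun i => (hl i).1] at hlt
      rw [dist_eq_norm]
      exact lt_of_pow_lt_pow_left₀ 2 hε.le hlt
  · intro h
    refine ⟨hf.memH2, fun ε hε => ?_⟩
    obtain ⟨s, hs, hd⟩ := h (Real.sqrt ε) (Real.sqrt_pos.mpr hε)
    obtain ⟨m, c, g, rfl⟩ := Submodule.mem_span_set'.mp hs
    choose lam hl hg using fun i => (g i).2
    refine ⟨m, c, lam, hl, ?_⟩
    rw [key m c lam fun i => (hl i).1]
    simp only [← hg, dist_eq_norm] at hd
    rw [← Real.sq_sqrt hε.le]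
    exact pow_lt_pow_left₀ hd (norm_nonneg _) (by norm_num)

lemma mem_orth (n : ℕ) (δ : ℝ) (x : Lp ℂ 2 cmu) (h : ∀ lam ∈ Icc 0 δ, inner ℂ x (VV n lam) = 0) :
    x ∈ (MM n δ)ᗮ := by
  rw [Submodule.mem_orthogonal]
  intro u hu
  induction hu using Submodule.span_induction with
  | mem u hu =>
    obtain ⟨lam, hl, rfl⟩ := hu
    rw [← inner_conj_symm, h lam hl, map_zero]
  | zero => simp
  | add a b _ _ ha hb => rw [inner_add_left, ha, hb, add_zero]
  | smul c a _ ha => rw [inner_smul_left, ha, mul_zero]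

lemma inner_closure (n : ℕ) (δ : ℝ) (x y : Lp ℂ 2 cmu) (hx : x ∈ (MM n δ)ᗮ)
    (hy : y ∈ (MM n δ).topologicalClosure) : inner ℂ x y = 0 := by
  rw [← Submodule.orthogonal_orthogonal_eq_closure, Submodule.mem_orthogonal] at hy
  exact hy x hx

lemma U_orth (n : ℕ) (δ : ℝ) (hδ : 0 < δ) {g : ℂ → ℂ} {G : Cir → ℂ} (hg : Bd g G) :
    (Bd_U n δ hδ.le hg).2.1.toLp _ ∈ (MM n δ)ᗮ := by
  apply mem_orth
  intro lam hl
  rw [VV, ip_toLp]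
  exact orth2 n δ lam hl hg

end HardyAux3

/-- For δ > 0 and n ≥ 0, the closed linear span in H²(𝔻) of {(1+z)^n φ^λ : 0 ≤ λ ≤ δ}
equals the model space K_{z^{n+1}φ^δ}. -/
theorem stmt16 (δ : ℝ) (hδ : 0 < δ) (n : ℕ) :
    ∀ f, InClosedSpan (fun lam z => (1 + z) ^ n * phi lam z) (Set.Icc 0 δ) f ↔
      MemK (fun z => z ^ (n + 1) * phi δ z) f := by

  intro f
  constructor
  · intro h
    obtain ⟨F, hF⟩ := h.1.exists_Bd
    refine ⟨h.1, fun g hg => ?_⟩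
    obtain ⟨G, hG⟩ := hg.exists_Bd
    rw [(Bd_U n δ hδ.le hG).hinner_eq hF]
    exact inner_closure n δ _ _ (U_orth n δ hδ hG) ((span_iff n δ hF).mp h)
  · rintro ⟨hf, h⟩
    obtain ⟨F, hF⟩ := hf.exists_Bd
    rw [span_iff n δ hF]
    set y := hF.2.1.toLp F with hy
    have : CompleteSpace (MM n δ).topologicalClosure :=
      (Submodule.isClosed_topologicalClosure _).completeSpace_coe
    obtain ⟨p, hp, u, hu, hyp⟩ :=
      (MM n δ).topologicalClosure.exists_add_mem_mem_orthogonal y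
    have hu' : u = y - p := by rw [hyp]; abel
    have huL : MemLp (u : Cir → ℂ) 2 cmu := Lp.memLp u
    have huE : huL.toLp _ = u := Lp.toLp_coeFn u huL
    have hperp : ∀ x ∈ (MM n δ)ᗮ, inner ℂ x y = 0 → inner ℂ x u = 0 := by
      intro x hx hxy
      rw [hu', inner_sub_right, hxy, inner_closure n δ x p hx hp, sub_zero]
    have hw : Integrable (fun t => (starRingEnd ℂ) (u t)) cmu :=
      (Complex.conjCLE : ℂ →L[ℝ] ℂ).integrable_comp (fc_int huL)
    have hcore := core δ hδ n (fun t => (starRingEnd ℂ) (u t)) hw ?_ ?_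
    · have hz : ∀ k : ℤ, fourierCoeff (u : Cir → ℂ) k = 0 := by
        intro k
        rcases k with k | k
        · have h2 := congrArg (starRingEnd ℂ) (hcore k)
          rw [← integral_conj, map_zero] at h2
          rw [← h2]
          refine integral_congr_ae (Filter.Eventually.of_forall fun t => ?_)
          simp only [map_mul, Complex.conj_conj, smul_eq_mul]
          rw [fourier_neg, ee_pow]
          rfl
        · rw [← basis_toLp huL, huE]
          apply hperp
          · apply mem_orth
            intro lam hl
            rw [VV, basis_toLp]
            exact (Bd_V n lam hl.1).2.2.2 k
          · rw [hy, basis_toLp]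
            exact hF.2.2.2 k
      have hu0 : u = 0 := by
        apply (fourierBasis : HilbertBasis ℤ ℂ (Lp ℂ 2 cmu)).repr.injective
        rw [map_zero]
        ext k
        rw [fourierBasis_repr, hz]
        rfl
      rw [hyp, hu0, add_zero]
      exact hp
    · intro lam hl
      have h1 : inner ℂ u (VV n lam) = 0 := by
        have := (Submodule.mem_orthogonal _ _).mp hu (VV n lam)
          (Submodule.le_topologicalClosure _ (Submodule.subset_span ⟨lam, hl, rfl⟩))
        rw [← inner_conj_symm, this, map_zero]
      rw [← huE, VV, ip_toLp] at h1
      rw [← h1]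
      refine integral_congr_ae (Filter.Eventually.of_forall fun t => ?_)
      simp only
      ring
    · intro k hk
      obtain ⟨d, rfl⟩ : ∃ d, k = n + 1 + d := ⟨k - (n + 1), by omega⟩
      have hB := Bd_U n δ hδ.le (Bd_eepow d)
      have h1 : inner ℂ (hB.2.1.toLp _) u = 0 := by
        apply hperp _ (U_orth n δ hδ (Bd_eepow d))
        rw [hy, ← hB.hinner_eq hF]
        exact h _ (Bd_eepow d).memH2
      rw [← huE, ← inner_conj_symm, ip_toLp, map_eq_zero] at h1
      rw [← h1]
      refine integral_congr_ae (Filter.Eventually.of_forall fun t => ?_)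
      simp only [pow_add]
      ring
end
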